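/- arXiv:2402.17578 — 2 statements merged into one kernel-verified Lean document; each statement's English description precedes it below -/
import Mathlib

section
/- Let ω be a weight function with constant K, g ∈ 𝒮_ω(ℝᴺ), g ≠ 0. For every λ ≥ 0 and f ∈ 𝒮_ω(ℝᴺ): ‖e^{λω} Rf‖_∞ ≤ (2π)^{−2N} ‖g‖₂^{−4} e^{K(1+2K)λ} ‖e^{K²λω} g‖_∞ ‖e^{K²λω} ĝ‖_∞ ‖e^{K²λω} V_g f‖₁². -/
open MeasureTheory Complex ENNReal

noncomputable section

abbrev RN (N : ℕ) := Fin N → ℝ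

def dotR {N : ℕ} (x y : RN N) : ℝ := ∑ i, x i * y i

def stft {N : ℕ} (g f : RN N → ℂ) (x ξ : RN N) : ℂ :=
  ∫ y, f y * (starRingEnd ℂ) (g (y - x)) * Complex.exp (-(Complex.I * (dotR y ξ : ℂ)))

def ftr {N : ℕ} (f : RN N → ℂ) (ξ : RN N) : ℂ :=
  ∫ x, Complex.exp (-(Complex.I * (dotR x ξ : ℂ))) * f x

def rihaczek {N : ℕ} (f : RN N → ℂ) (x ξ : RN N) : ℂ :=
  Complex.exp (-(Complex.I * (dotR x ξ : ℂ))) * f x * (starRingEnd ℂ) (ftr f ξ)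

def spec {N : ℕ} (g f : RN N → ℂ) (x ξ : RN N) : ℝ := ‖stft g f x ξ‖ ^ 2

def wig {N : ℕ} (τ : ℝ) (f : RN N → ℂ) (x ξ : RN N) : ℂ :=
  ∫ t, Complex.exp (-(Complex.I * (dotR t ξ : ℂ))) * f (x + τ • t) *
    (starRingEnd ℂ) (f (x - (1 - τ) • t))

structure WeightFunction where
  w : ℝ → ℝ
  K : ℝ
  a : ℝ
  b : ℝ
  oneLeK : 1 ≤ K
  bpos : 0 < b
  cont : Continuous w
  mono : MonotoneOn w (Set.Ici 0)
  nonneg : ∀ t, 0 ≤ w t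
  alpha : ∀ t, 0 ≤ t → w (2 * t) ≤ K * (1 + w t)
  beta : Filter.Tendsto (fun t => w t / t) Filter.atTop (nhds 0)
  gamma : ∀ t, 0 ≤ t → a + b * Real.log (1 + t) ≤ w t
  delta : ConvexOn ℝ Set.univ (fun t => w (Real.exp t))
  subadd : ∀ s t, 0 ≤ s → 0 ≤ t → w (s + t) ≤ K * (1 + w s + w t)

def wnorm (W : WeightFunction) (lam : ℝ) {E : Type*} [NormedAddCommGroup E]
    [MeasurableSpace E] (μ : Measure E) {F : Type*} [NormedAddCommGroup F]
    (f : E → F) (p : ℝ≥0∞) : ℝ≥0∞ :=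
  eLpNorm (fun t => Real.exp (lam * W.w ‖t‖) * ‖f t‖) p μ

def SOmega {N : ℕ} (W : WeightFunction) (f : RN N → ℂ) : Prop :=
  ∀ lam : ℝ, 0 < lam →
    (∃ C, ∀ x, Real.exp (lam * W.w ‖x‖) * ‖f x‖ ≤ C) ∧
    (∃ C, ∀ ξ, Real.exp (lam * W.w ‖ξ‖) * ‖ftr f ξ‖ ≤ C)

def elpN {α : Type*} [MeasurableSpace α] (μ : Measure α) (h : α → ℝ≥0∞) (p : ℝ≥0∞) : ℝ≥0∞ :=
  if p = ∞ then essSup h μ else (∫⁻ z, (h z) ^ p.toReal ∂μ) ^ (1 / p.toReal)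

end

open scoped SchwartzMap FourierTransform

lemma dotR_eq_inner {N : ℕ} (x y : RN N) :
    dotR x y = inner ℝ (WithLp.toLp 2 x) (WithLp.toLp 2 y) := by
  simp [dotR, PiLp.inner_apply, mul_comm]

lemma ftr_eq_fourier {N : ℕ} (f : RN N → ℂ) (w : EuclideanSpace ℝ (Fin N)) :
    ftr f ((2 * Real.pi) • w.ofLp) = 𝓕 (fun v : EuclideanSpace ℝ (Fin N) => f v.ofLp) w := by
  rw [Real.fourier_eq', ftr, ← (PiLp.volume_preserving_toLp (Fin N)).integral_comp
    (MeasurableEquiv.toLp 2 (Fin N → ℝ)).measurableEmbedding]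
  refine integral_congr_ae (.of_forall fun x => ?_)
  simp only [smul_eq_mul, dotR, PiLp.inner_apply]
  congr 2
  push_cast [Finset.mul_sum, Finset.sum_mul]
  rw [← Finset.sum_neg_distrib]
  refine Finset.sum_congr rfl fun i _ => ?_
  simp
  ring

/-- The Fourier transform `ftr f` of a Schwartz function, as a Schwartz function. -/
noncomputable def SchwartzMap.ftr {N : ℕ} (f : 𝓢(RN N, ℂ)) : 𝓢(RN N, ℂ) :=
  compCLMOfContinuousLinearEquiv ℂ
    ((ContinuousLinearEquiv.smulLeft (Units.mk0 (2 * Real.pi)⁻¹ (by positivity))).trans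
      (EuclideanSpace.equiv (Fin N) ℝ).symm)
    (𝓕 (compCLMOfContinuousLinearEquiv ℂ (EuclideanSpace.equiv (Fin N) ℝ) f))

lemma SchwartzMap.coe_ftr {N : ℕ} (f : 𝓢(RN N, ℂ)) : ⇑f.ftr = _root_.ftr ⇑f := by
  ext ξ
  have := ftr_eq_fourier f (WithLp.toLp 2 ((2 * Real.pi)⁻¹ • ξ))
  rw [smul_inv_smul₀ (by positivity)] at this
  rw [this]
  rfl

lemma SchwartzMap.ftr_inversion {N : ℕ} (f : 𝓢(RN N, ℂ)) (y : RN N) :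
    f y = ((2 * Real.pi) ^ N : ℝ)⁻¹ • ∫ ξ, Complex.exp (Complex.I * (dotR y ξ : ℂ)) * f.ftr ξ := by
  have h := congrArg (fun F => F (WithLp.toLp 2 y)) (FourierTransform.fourierInv_fourier_eq
    (F := 𝓢(EuclideanSpace ℝ (Fin N), ℂ))
    (compCLMOfContinuousLinearEquiv ℂ (EuclideanSpace.equiv (Fin N) ℝ) f))
  simp only [fourierInv_coe, fourier_coe] at h
  rw [Real.fourierInv_eq', ← (PiLp.volume_preserving_toLp (Fin N)).integral_comp
    (MeasurableEquiv.toLp 2 (Fin N → ℝ)).measurableEmbedding] at h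
  have h2 : f y = compCLMOfContinuousLinearEquiv ℂ (EuclideanSpace.equiv (Fin N) ℝ) f
    (WithLp.toLp 2 y) := rfl
  rw [h2, ← h]
  have h3 := Measure.integral_comp_smul (volume : Measure (RN N))
    (fun ξ => Complex.exp (Complex.I * (dotR y ξ : ℂ)) * f.ftr ξ) (2 * Real.pi)
  rw [Module.finrank_fin_fun, abs_of_pos (by positivity)] at h3
  rw [← h3]
  refine integral_congr_ae (.of_forall fun x => ?_)
  simp only [smul_eq_mul]
  rw [coe_ftr]
  rw [show (2 * Real.pi) • x = (2 * Real.pi) • (WithLp.toLp 2 x).ofLp from rfl,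
    ftr_eq_fourier]
  congr 2
  rw [real_inner_comm, ← dotR_eq_inner]
  push_cast [dotR, Finset.mul_sum, Finset.sum_mul]
  refine Finset.sum_congr rfl fun i _ => ?_
  simp
  ring

/-- The character phase `x ↦ exp(-i x·ξ)` has norm one. -/
lemma norm_exp_neg_I_dotR {N : ℕ} (x ξ : RN N) :
    ‖Complex.exp (-(Complex.I * (dotR x ξ : ℂ)))‖ = 1 := by
  rw [← mul_neg, mul_comm, ← Complex.ofReal_neg, Complex.norm_exp_ofReal_mul_I]

lemma continuous_dotR {N : ℕ} : Continuous fun p : RN N × RN N => dotR p.1 p.2 := by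
  unfold dotR; fun_prop

lemma dotR_comm {N : ℕ} (x y : RN N) : dotR x y = dotR y x := by
  simp [dotR, mul_comm]

lemma integral_ftr_mul {N : ℕ} {f g : RN N → ℂ} (hf : Integrable f) (hg : Integrable g) :
    ∫ ξ, ftr f ξ * g ξ = ∫ x, f x * ftr g x := by
  let L : RN N →ₗ[ℝ] RN N →ₗ[ℝ] ℝ := LinearMap.mk₂ ℝ (fun x y => (2 * Real.pi)⁻¹ * dotR x y)
    (by intros; simp [dotR, add_mul, Finset.sum_add_distrib, mul_add])
    (by intros; simp [dotR, Finset.mul_sum]; refine Finset.sum_congr rfl fun _ _ => by ring)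
    (by intros; simp [dotR, mul_add, Finset.sum_add_distrib])
    (by intros; simp [dotR, Finset.mul_sum]; refine Finset.sum_congr rfl fun _ _ => by ring)
  have hLap : ∀ x y, L x y = (2 * Real.pi)⁻¹ * dotR x y := fun _ _ => rfl
  have key : ∀ h : RN N → ℂ, ftr h = VectorFourier.fourierIntegral 𝐞 volume L h := by
    intro h
    ext ξ
    simp only [ftr, VectorFourier.fourierIntegral, Circle.smul_def, Real.fourierChar_apply,
      smul_eq_mul, hLap]
    refine integral_congr_ae (.of_forall fun x => ?_)
    simp only
    congr 2
    push_cast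
    have : (Real.pi : ℂ) ≠ 0 := by exact_mod_cast Real.pi_ne_zero
    field_simp
  have hflip : L.flip = L := by
    refine LinearMap.ext₂ fun x y => ?_
    rw [LinearMap.flip_apply, hLap, hLap, dotR_comm]
  have := VectorFourier.integral_fourierIntegral_smul_eq_flip (μ := (volume : Measure (RN N)))
    (ν := (volume : Measure (RN N))) (L := L) (f := f) (g := g) Real.continuous_fourierChar
    (continuous_const.mul continuous_dotR) hf hg
  rw [hflip, ← key, ← key] at this
  exact this

lemma parseval {N : ℕ} (f : 𝓢(RN N, ℂ)) {k : RN N → ℂ} (hk : Integrable k) :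
    ∫ y, f y * (starRingEnd ℂ) (k y) =
      ((2 * Real.pi) ^ N : ℝ)⁻¹ • ∫ η, ftr f η * (starRingEnd ℂ) (ftr k η) := by
  have h1 : ∀ y, f y = ((2 * Real.pi) ^ N : ℝ)⁻¹ • ftr f.ftr (-y) := by
    intro y
    rw [f.ftr_inversion y, ftr]
    congr 1
    refine integral_congr_ae (.of_forall fun ξ => ?_)
    simp [dotR, mul_comm]
  have hk' : Integrable (fun y => (starRingEnd ℂ) (k (-y))) :=
    (LinearIsometryEquiv.integrable_comp_iff Complex.conjLIE).2 hk.comp_neg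
  have h2 : ∫ y, f y * (starRingEnd ℂ) (k y) =
      ((2 * Real.pi) ^ N : ℝ)⁻¹ • ∫ y, ftr f.ftr y * (starRingEnd ℂ) (k (-y)) := by
    rw [← integral_neg_eq_self (fun y => ftr f.ftr y * (starRingEnd ℂ) (k (-y))),
      ← integral_smul]
    refine integral_congr_ae (.of_forall fun y => ?_)
    simp only [neg_neg]
    rw [h1 y, smul_mul_assoc]
  rw [h2, integral_ftr_mul f.ftr.integrable hk']
  congr 1
  refine integral_congr_ae (.of_forall fun η => ?_)
  simp only [SchwartzMap.coe_ftr]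
  congr 1
  rw [ftr, ftr, ← integral_conj, ← integral_neg_eq_self]
  refine integral_congr_ae (.of_forall fun x => ?_)
  simp [← Complex.exp_conj, dotR]

lemma stft_eq_ftr {N : ℕ} (g f : RN N → ℂ) (x ξ : RN N) :
    stft g f x ξ = ftr (fun y => f y * (starRingEnd ℂ) (g (y - x))) ξ :=
  integral_congr_ae (.of_forall fun _ => mul_comm _ _)

lemma stft_eq_stft_ftr {N : ℕ} (g f : 𝓢(RN N, ℂ)) (x ξ : RN N) :
    stft g f x ξ = ((2 * Real.pi) ^ N : ℝ)⁻¹ •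
      (Complex.exp (-(Complex.I * (dotR x ξ : ℂ))) * stft g.ftr f.ftr ξ (-x)) := by
  have hk : Integrable fun y => g (y - x) * Complex.exp (Complex.I * (dotR y ξ : ℂ)) := by
    refine (g.integrable.comp_sub_right x).mul_bdd (c := 1) ?_ (.of_forall fun y => ?_)
    · refine Continuous.aestronglyMeasurable ?_
      unfold dotR; fun_prop
    · rw [mul_comm, Complex.norm_exp_ofReal_mul_I]
  have hftr : ∀ η, ftr (fun y => g (y - x) * Complex.exp (Complex.I * (dotR y ξ : ℂ))) η =
      Complex.exp (-(Complex.I * (dotR x (η - ξ) : ℂ))) * ftr g (η - ξ) := by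
    intro η
    rw [ftr, ftr, ← integral_const_mul, ← integral_add_right_eq_self _ x]
    refine integral_congr_ae (.of_forall fun y => ?_)
    simp only [add_sub_cancel_right]
    rw [mul_comm (g y), ← mul_assoc, ← mul_assoc, ← Complex.exp_add, ← Complex.exp_add]
    congr 2
    simp only [dotR, Pi.add_apply, Pi.sub_apply, add_mul, mul_sub, Finset.sum_add_distrib,
      Finset.sum_sub_distrib]
    push_cast
    ring
  have h := parseval f hk
  rw [stft, stft, ← integral_const_mul]
  convert h using 1
  · refine integral_congr_ae (.of_forall fun _ => ?_)
    simp [← Complex.exp_conj, mul_assoc]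
  · congr 1
    refine integral_congr_ae (.of_forall fun η => ?_)
    simp only [hftr, SchwartzMap.coe_ftr, map_mul, ← Complex.exp_conj]
    have he : Complex.exp ((starRingEnd ℂ) (-(Complex.I * (dotR x (η - ξ) : ℂ)))) =
        Complex.exp (-(Complex.I * (dotR x ξ : ℂ))) *
          Complex.exp (-(Complex.I * (dotR η (-x) : ℂ))) := by
      rw [← Complex.exp_add]
      congr 1
      simp only [dotR, map_neg, map_mul, Complex.conj_I, Complex.conj_ofReal, Pi.sub_apply,
        Pi.neg_apply, mul_sub, Finset.sum_sub_distrib, mul_comm (η _)]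
      push_cast
      simp only [neg_mul, mul_neg, Finset.sum_neg_distrib]
      ring
    rw [he]
    ring

lemma enorm_stft_ftr {N : ℕ} (g f : 𝓢(RN N, ℂ)) (x ξ : RN N) :
    ‖stft g.ftr f.ftr ξ (-x)‖ₑ = ENNReal.ofReal ((2 * Real.pi) ^ N) * ‖stft g f x ξ‖ₑ := by
  have hpi : (0 : ℝ) < (2 * Real.pi) ^ N := by positivity
  rw [stft_eq_stft_ftr g f x ξ, enorm_smul, enorm_mul, ← ofReal_norm (Complex.exp _),
    norm_exp_neg_I_dotR, Real.enorm_of_nonneg (by positivity), ← mul_assoc,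
    ← ENNReal.ofReal_mul hpi.le, mul_inv_cancel₀ hpi.ne']
  simp

lemma measurable_stft {N : ℕ} (g f : 𝓢(RN N, ℂ)) :
    Measurable fun z : RN N × RN N => stft g f z.1 z.2 := by
  have : Continuous fun p : (RN N × RN N) × RN N => f p.2 * (starRingEnd ℂ) (g (p.2 - p.1.1)) *
      Complex.exp (-(Complex.I * (dotR p.2 p.1.2 : ℂ))) := by
    unfold dotR
    have := f.continuous
    have := g.continuous
    refine .mul (.mul (by fun_prop) (Complex.continuous_conj.comp (by fun_prop))) (by fun_prop)
  exact (this.stronglyMeasurable.integral_prod_right' (ν := volume)).measurable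

/-- The Schwartz function `y ↦ f y * conj (g (y - x))`. -/
noncomputable def SchwartzMap.window {N : ℕ} (g f : 𝓢(RN N, ℂ)) (x : RN N) : 𝓢(RN N, ℂ) :=
  bilinLeftCLM (ContinuousLinearMap.mul ℝ ℂ)
    (((g.compSubConstCLM ℝ x).postcompCLM
      (Complex.conjCLE : ℂ →L[ℝ] ℂ)).hasTemperateGrowth) f

lemma SchwartzMap.window_apply {N : ℕ} (g f : 𝓢(RN N, ℂ)) (x y : RN N) :
    window g f x y = f y * (starRingEnd ℂ) (g (y - x)) := rfl

lemma enorm_mul_lintegral_le {N : ℕ} (g f : 𝓢(RN N, ℂ)) (y : RN N) :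
    ENNReal.ofReal ((2 * Real.pi) ^ N) * (‖f y‖ₑ * ∫⁻ x, ‖g x‖ₑ ^ 2) ≤
      ∫⁻ z : RN N × RN N, ‖stft g f z.1 z.2‖ₑ * ‖g (y - z.1)‖ₑ := by
  have hpi : (0 : ℝ) < (2 * Real.pi) ^ N := by positivity
  have h1 : ∀ x, ENNReal.ofReal ((2 * Real.pi) ^ N) * (‖f y‖ₑ * ‖g (y - x)‖ₑ) ≤
      ∫⁻ ξ, ‖stft g f x ξ‖ₑ := by
    intro x
    have h := (SchwartzMap.window g f x).ftr_inversion y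
    have h2 : ‖f y‖ₑ * ‖g (y - x)‖ₑ = ‖SchwartzMap.window g f x y‖ₑ := by
      rw [SchwartzMap.window_apply, enorm_mul, ← ofReal_norm (starRingEnd ℂ _),
        RCLike.norm_conj, ofReal_norm]
    rw [h2, h, enorm_smul, Real.enorm_of_nonneg (by positivity), ← mul_assoc,
      ← ENNReal.ofReal_mul hpi.le, mul_inv_cancel₀ hpi.ne', ENNReal.ofReal_one, one_mul]
    refine (enorm_integral_le_lintegral_enorm _).trans (lintegral_mono fun ξ => ?_)
    rw [enorm_mul, ← ofReal_norm (Complex.exp _), mul_comm Complex.I,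
      Complex.norm_exp_ofReal_mul_I, ENNReal.ofReal_one, one_mul, stft_eq_ftr,
      SchwartzMap.coe_ftr]
    rfl
  have hm := (measurable_stft g f).enorm
  have hg := g.continuous
  have hm2 : Measurable fun z : RN N × RN N => ‖stft g f z.1 z.2‖ₑ * ‖g (y - z.1)‖ₑ :=
    hm.mul (hg.measurable.comp (measurable_const.sub measurable_fst)).enorm
  rw [Measure.volume_eq_prod, lintegral_prod _ hm2.aemeasurable]
  calc _ = ∫⁻ x, ENNReal.ofReal ((2 * Real.pi) ^ N) * (‖f y‖ₑ * ‖g (y - x)‖ₑ) * ‖g (y - x)‖ₑ := by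
        rw [← lintegral_sub_left_eq_self _ y, ← lintegral_const_mul' _ _ (by simp),
          ← lintegral_const_mul' _ _ (by simp)]
        simp only [sq, mul_assoc]
    _ ≤ ∫⁻ x, (∫⁻ ξ, ‖stft g f x ξ‖ₑ) * ‖g (y - x)‖ₑ := by
        gcongr with x
        exact h1 x
    _ = _ := by
        refine lintegral_congr fun x => ?_
        exact (lintegral_mul_const' _ _ (by simp)).symm

lemma lintegral_enorm_sq {N : ℕ} (h : 𝓢(RN N, ℂ)) :
    ∫⁻ x, ‖h x‖ₑ ^ 2 = ENNReal.ofReal (∫ x, ‖h x‖ ^ 2) := by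
  have hi : Integrable fun x => ‖h x‖ ^ 2 := (h.memLp 2).integrable_norm_pow two_ne_zero
  rw [ofReal_integral_eq_lintegral_ofReal hi (.of_forall fun _ => by positivity)]
  refine lintegral_congr fun x => ?_
  rw [ENNReal.ofReal_pow (norm_nonneg _), ofReal_norm]

lemma lintegral_enorm_ftr_sq {N : ℕ} (g : 𝓢(RN N, ℂ)) :
    ∫⁻ ξ, ‖g.ftr ξ‖ₑ ^ 2 = ENNReal.ofReal ((2 * Real.pi) ^ N) * ∫⁻ x, ‖g x‖ₑ ^ 2 := by
  have hpi : (0 : ℝ) < (2 * Real.pi) ^ N := by positivity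
  rw [lintegral_enorm_sq, lintegral_enorm_sq, ← ENNReal.ofReal_mul hpi.le]
  congr 1
  have h := parseval g g.integrable
  simp only [Complex.mul_conj, Complex.normSq_eq_norm_sq] at h
  rw [integral_complex_ofReal, integral_complex_ofReal, Complex.real_smul, ← Complex.ofReal_mul,
    Complex.ofReal_inj] at h
  rw [h, g.coe_ftr, mul_inv_cancel_left₀ hpi.ne']

lemma enorm_ftr_mul_lintegral_le {N : ℕ} (g f : 𝓢(RN N, ℂ)) (ξ : RN N) :
    ENNReal.ofReal ((2 * Real.pi) ^ N) * (‖f.ftr ξ‖ₑ * ∫⁻ x, ‖g x‖ₑ ^ 2) ≤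
      ∫⁻ z : RN N × RN N, ‖stft g f z.1 z.2‖ₑ * ‖g.ftr (ξ - z.2)‖ₑ := by
  have hpi : (0 : ℝ) < (2 * Real.pi) ^ N := by positivity
  have h := enorm_mul_lintegral_le g.ftr f.ftr ξ
  have hm := (measurable_stft g f).enorm
  have hm' := (measurable_stft g.ftr f.ftr).enorm
  have hg := g.ftr.continuous
  have hm2 : Measurable fun z : RN N × RN N =>
      ‖stft g.ftr f.ftr z.1 z.2‖ₑ * ‖g.ftr (ξ - z.1)‖ₑ :=
    hm'.mul (hg.measurable.comp (measurable_const.sub measurable_fst)).enorm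
  have hm3 : Measurable fun z : RN N × RN N =>
      ‖stft g f z.1 z.2‖ₑ * ‖g.ftr (ξ - z.2)‖ₑ :=
    hm.mul (hg.measurable.comp (measurable_const.sub measurable_snd)).enorm
  rw [lintegral_enorm_ftr_sq, Measure.volume_eq_prod, lintegral_prod _ hm2.aemeasurable] at h
  have h2 : ∀ a, ∫⁻ b, ‖stft g.ftr f.ftr a b‖ₑ * ‖g.ftr (ξ - a)‖ₑ =
      ENNReal.ofReal ((2 * Real.pi) ^ N) * ∫⁻ b, ‖stft g f b a‖ₑ * ‖g.ftr (ξ - a)‖ₑ := by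
    intro a
    rw [← lintegral_neg_eq_self, ← lintegral_const_mul' _ _ (by simp)]
    simp only [enorm_stft_ftr, mul_assoc]
  simp only [h2] at h
  rw [lintegral_const_mul' _ _ (by simp), ENNReal.mul_le_mul_iff_right (by simpa using hpi)
    (by simp)] at h
  rw [Measure.volume_eq_prod, lintegral_prod_symm _ hm3.aemeasurable]
  refine le_trans (le_of_eq ?_) h
  ring

namespace WeightFunction

variable (W : WeightFunction)

lemma w_norm_le {E : Type*} [NormedAddCommGroup E] (x y : E) :
    W.w ‖x‖ ≤ W.K * (1 + W.w ‖y‖ + W.w ‖x - y‖) := by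
  refine le_trans (W.mono (norm_nonneg _) (Set.mem_Ici.2 (by positivity)) ?_)
    (W.subadd _ _ (norm_nonneg y) (norm_nonneg (x - y)))
  simpa using norm_add_le y (x - y)

lemma exp_w_norm_le {E : Type*} [NormedAddCommGroup E] {μ : ℝ} (hμ : 0 ≤ μ) (x y : E) :
    Real.exp (μ * W.w ‖x‖) ≤ Real.exp (W.K * μ) *
      (Real.exp (W.K * μ * W.w ‖y‖) * Real.exp (W.K * μ * W.w ‖x - y‖)) := by
  rw [← Real.exp_add, ← Real.exp_add, Real.exp_le_exp]
  nlinarith [mul_le_mul_of_nonneg_left (W.w_norm_le x y) hμ]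

lemma exists_integrable_exp_neg {E : Type*} [NormedAddCommGroup E] [NormedSpace ℝ E]
    [FiniteDimensional ℝ E] [MeasurableSpace E] [BorelSpace E] (ν : Measure E)
    [ν.IsAddHaarMeasure] :
    ∃ M, 0 < M ∧ Integrable (fun x : E => Real.exp (-(M * W.w ‖x‖))) ν := by
  have hb := W.bpos
  refine ⟨(Module.finrank ℝ E + 1) / W.b, by positivity, ?_⟩
  set M := (Module.finrank ℝ E + 1) / W.b with hM
  have hMb : M * W.b = Module.finrank ℝ E + 1 := div_mul_cancel₀ _ hb.ne'
  have h := (integrable_one_add_norm (E := E) (μ := ν)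
    (r := Module.finrank ℝ E + 1) (by simp)).const_mul (Real.exp (-(M * W.a)))
  have hc := W.cont
  refine h.mono' (Continuous.aestronglyMeasurable (by fun_prop)) (.of_forall fun x => ?_)
  have hx : 0 < 1 + ‖x‖ := by positivity
  rw [Real.norm_of_nonneg (by positivity), Real.rpow_def_of_pos hx, ← Real.exp_add,
    Real.exp_le_exp, ← hMb]
  have hM0 : 0 < M := by positivity
  nlinarith [mul_le_mul_of_nonneg_left (W.gamma ‖x‖ (norm_nonneg x)) hM0.le]

/-- `f` decays faster than every exponential of the weight. -/
def RapidDecay {E : Type*} [NormedAddCommGroup E] (f : E → ℂ) : Prop :=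
  ∀ μ : ℝ, ∃ C, ∀ x, Real.exp (μ * W.w ‖x‖) * ‖f x‖ ≤ C

variable {W}

lemma rapidDecay_of_pos {E : Type*} [NormedAddCommGroup E] {f : E → ℂ}
    (h : ∀ μ : ℝ, 0 < μ → ∃ C, ∀ x, Real.exp (μ * W.w ‖x‖) * ‖f x‖ ≤ C) : W.RapidDecay f := by
  intro μ
  obtain ⟨C, hC⟩ := h (max μ 1) (by positivity)
  refine ⟨C, fun x => le_trans ?_ (hC x)⟩
  have := W.nonneg ‖x‖
  gcongr
  exact le_max_left _ _

lemma RapidDecay.stft_fst {N : ℕ} {g f : RN N → ℂ} (hg : W.RapidDecay g) (hf : W.RapidDecay f)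
    {μ : ℝ} (hμ : 0 ≤ μ) :
    ∃ C, ∀ x ξ, Real.exp (μ * W.w ‖x‖) * ‖stft g f x ξ‖ ≤ C := by
  obtain ⟨M, -, hM⟩ := W.exists_integrable_exp_neg (volume : Measure (RN N))
  obtain ⟨A, hA⟩ := hg (W.K * μ)
  obtain ⟨B, hB⟩ := hf (W.K * μ + M)
  refine ⟨∫ y : RN N, Real.exp (W.K * μ) * A * B * Real.exp (-(M * W.w ‖y‖)), fun x ξ => ?_⟩
  rw [← Real.norm_of_nonneg (Real.exp_pos (μ * W.w ‖x‖)).le, ← norm_smul, stft,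
    ← integral_smul]
  refine norm_integral_le_of_norm_le (hM.const_mul _) (.of_forall fun y => ?_)
  rw [norm_smul, norm_mul, norm_mul, norm_exp_neg_I_dotR, RCLike.norm_conj, mul_one,
    Real.norm_of_nonneg (Real.exp_pos _).le]
  have hB' : Real.exp (W.K * μ * W.w ‖y‖) * ‖f y‖ ≤ B * Real.exp (-(M * W.w ‖y‖)) := by
    rw [Real.exp_neg, ← div_eq_mul_inv, le_div_iff₀ (Real.exp_pos _)]
    refine le_trans (le_of_eq ?_) (hB y)
    rw [add_mul, Real.exp_add]
    ring
  calc _ ≤ Real.exp (W.K * μ) * (Real.exp (W.K * μ * W.w ‖y‖) *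
          Real.exp (W.K * μ * W.w ‖x - y‖)) * (‖f y‖ * ‖g (y - x)‖) := by
        gcongr
        exact W.exp_w_norm_le hμ x y
    _ = Real.exp (W.K * μ) * ((Real.exp (W.K * μ * W.w ‖y - x‖) * ‖g (y - x)‖) *
          (Real.exp (W.K * μ * W.w ‖y‖) * ‖f y‖)) := by
        rw [norm_sub_rev x y]; ring
    _ ≤ Real.exp (W.K * μ) * (A * (B * Real.exp (-(M * W.w ‖y‖)))) := by
        have hA0 : 0 ≤ A := le_trans (by positivity) (hA 0)
        gcongr
        exact hA _
    _ = _ := by ring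

lemma RapidDecay.lintegral_stft_ne_top {N : ℕ} {g f : 𝓢(RN N, ℂ)} (hg : W.RapidDecay g)
    (hf : W.RapidDecay f) (hg' : W.RapidDecay g.ftr) (hf' : W.RapidDecay f.ftr)
    {μ : ℝ} (hμ : 0 ≤ μ) :
    ∫⁻ z : RN N × RN N, ENNReal.ofReal (Real.exp (μ * W.w ‖z‖)) * ‖stft g f z.1 z.2‖ₑ ≠ ⊤ := by
  have : (volume : Measure (RN N × RN N)).IsAddHaarMeasure :=
    Measure.prod.instIsAddHaarMeasure volume volume
  obtain ⟨M, hM0, hM⟩ := W.exists_integrable_exp_neg (volume : Measure (RN N × RN N))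
  obtain ⟨A, hA⟩ := hg.stft_fst hf (μ := μ + M) (by positivity)
  obtain ⟨B, hB⟩ := hg'.stft_fst hf' (μ := μ + M) (by positivity)
  have hB' : ∀ x ξ, Real.exp ((μ + M) * W.w ‖ξ‖) * ‖stft g f x ξ‖ ≤
      ((2 * Real.pi) ^ N)⁻¹ * B := by
    intro x ξ
    have hpi : (0 : ℝ) < (2 * Real.pi) ^ N := by positivity
    rw [stft_eq_stft_ftr g f x ξ, norm_smul, norm_mul, norm_exp_neg_I_dotR, one_mul,
      Real.norm_of_nonneg (by positivity), mul_left_comm]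
    gcongr
    exact hB ξ (-x)
  set C := max A (((2 * Real.pi) ^ N)⁻¹ * B)
  have hC : ∀ z : RN N × RN N, Real.exp ((μ + M) * W.w ‖z‖) * ‖stft g f z.1 z.2‖ ≤ C := by
    intro z
    rcases max_choice ‖z.1‖ ‖z.2‖ with h | h
    · rw [Prod.norm_def, h]
      exact (hA _ _).trans (le_max_left _ _)
    · rw [Prod.norm_def, h]
      exact (hB' _ _).trans (le_max_right _ _)
  refine ne_top_of_le_ne_top (hM.const_mul C).lintegral_lt_top.ne (lintegral_mono fun z => ?_)
  rw [← ofReal_norm, ← ENNReal.ofReal_mul (Real.exp_pos _).le]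
  refine ENNReal.ofReal_le_ofReal ?_
  rw [Real.exp_neg, ← div_eq_mul_inv, le_div_iff₀ (Real.exp_pos _)]
  refine le_trans (le_of_eq ?_) (hC z)
  rw [add_mul, Real.exp_add]
  ring

/-- A convolution-type bound transfers to weighted norms. -/
lemma exp_mul_le_of_le_lintegral {N : ℕ} {h : RN N → ℂ} {V : RN N × RN N → ℂ}
    {p : RN N × RN N → RN N} (hp : ∀ z, ‖p z‖ ≤ ‖z‖) {x : RN N} {c A : ℝ≥0∞} (hA : A ≠ ⊤)
    {μ : ℝ} (hμ : 0 ≤ μ) (hh : ∀ t, ENNReal.ofReal (Real.exp (W.K * μ * W.w ‖t‖)) * ‖h t‖ₑ ≤ A)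
    (hc : c ≤ ∫⁻ z, ‖V z‖ₑ * ‖h (x - p z)‖ₑ) :
    ENNReal.ofReal (Real.exp (μ * W.w ‖x‖)) * c ≤ ENNReal.ofReal (Real.exp (W.K * μ)) * A *
      ∫⁻ z, ENNReal.ofReal (Real.exp (W.K * μ * W.w ‖z‖)) * ‖V z‖ₑ := by
  have hK : 0 ≤ W.K := zero_le_one.trans W.oneLeK
  refine (mul_le_mul_right hc _).trans ?_
  rw [← lintegral_const_mul' _ _ (by finiteness), ← lintegral_const_mul' _ _ (by finiteness)]
  refine lintegral_mono fun z => ?_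
  have hw : ENNReal.ofReal (Real.exp (μ * W.w ‖x‖)) ≤ ENNReal.ofReal (Real.exp (W.K * μ)) *
      (ENNReal.ofReal (Real.exp (W.K * μ * W.w ‖z‖)) *
        ENNReal.ofReal (Real.exp (W.K * μ * W.w ‖x - p z‖))) := by
    rw [← ENNReal.ofReal_mul (Real.exp_pos _).le, ← ENNReal.ofReal_mul (Real.exp_pos _).le]
    refine ENNReal.ofReal_le_ofReal ((W.exp_w_norm_le hμ x (p z)).trans ?_)
    gcongr
    exact W.mono (norm_nonneg _) (norm_nonneg _) (hp z)
  calc _ ≤ ENNReal.ofReal (Real.exp (W.K * μ)) *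
      (ENNReal.ofReal (Real.exp (W.K * μ * W.w ‖z‖)) *
        ENNReal.ofReal (Real.exp (W.K * μ * W.w ‖x - p z‖))) * (‖V z‖ₑ * ‖h (x - p z)‖ₑ) := by
        gcongr
    _ = ENNReal.ofReal (Real.exp (W.K * μ)) *
      (ENNReal.ofReal (Real.exp (W.K * μ * W.w ‖x - p z‖)) * ‖h (x - p z)‖ₑ) *
      (ENNReal.ofReal (Real.exp (W.K * μ * W.w ‖z‖)) * ‖V z‖ₑ) := by ring
    _ ≤ _ := by
        gcongr
        exact hh _

lemma RapidDecay.wnorm_top_ne_top {N : ℕ} {f : RN N → ℂ} (hf : W.RapidDecay f) (μ : ℝ) :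
    wnorm W μ volume f ⊤ ≠ ⊤ := by
  obtain ⟨C, hC⟩ := hf μ
  refine ne_top_of_le_ne_top (b := ENNReal.ofReal C) ENNReal.ofReal_ne_top ?_
  rw [wnorm, eLpNorm_exponent_top]
  refine eLpNormEssSup_le_of_ae_bound (.of_forall fun x => ?_)
  rw [Real.norm_of_nonneg (by positivity)]
  exact hC x

lemma exp_mul_enorm_le_wnorm_top {N : ℕ} {f : RN N → ℂ} (hf : Continuous f) (μ : ℝ) (t : RN N) :
    ENNReal.ofReal (Real.exp (μ * W.w ‖t‖)) * ‖f t‖ₑ ≤ wnorm W μ volume f ⊤ := by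
  have hc := W.cont
  have hcont : Continuous fun t => ‖Real.exp (μ * W.w ‖t‖) * ‖f t‖‖ₑ := by fun_prop
  have h : ‖Real.exp (μ * W.w ‖t‖) * ‖f t‖‖ₑ ≤ wnorm W μ volume f ⊤ := by
    rw [wnorm, eLpNorm_exponent_top]
    by_contra! hlt
    have hopen : IsOpen {t | eLpNormEssSup (fun t => Real.exp (μ * W.w ‖t‖) * ‖f t‖) volume <
        ‖Real.exp (μ * W.w ‖t‖) * ‖f t‖‖ₑ} := isOpen_lt continuous_const hcont
    have hpos := hopen.measure_pos volume ⟨t, hlt⟩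
    exact hpos.ne' meas_eLpNormEssSup_lt
  rwa [enorm_mul, Real.enorm_of_nonneg (Real.exp_pos _).le, enorm_norm] at h

lemma wnorm_one {N : ℕ} (V : RN N × RN N → ℂ) (μ : ℝ) : wnorm W μ volume V 1 =
    ∫⁻ z, ENNReal.ofReal (Real.exp (μ * W.w ‖z‖)) * ‖V z‖ₑ := by
  rw [wnorm, eLpNorm_one_eq_lintegral_enorm]
  refine lintegral_congr fun z => ?_
  rw [enorm_mul, Real.enorm_of_nonneg (Real.exp_pos _).le, enorm_norm]

end WeightFunction

lemma eLpNorm_two_toReal_pow_four {N : ℕ} (g : 𝓢(RN N, ℂ)) :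
    (eLpNorm g 2 volume).toReal ^ 4 = (∫⁻ x, ‖g x‖ₑ ^ 2).toReal ^ 2 := by
  have h := eLpNorm_nnreal_pow_eq_lintegral (f := g) (μ := volume) (p := 2) (by simp)
  simp only [NNReal.coe_ofNat, ENNReal.coe_ofNat, ENNReal.rpow_ofNat] at h
  rw [← h, ENNReal.toReal_pow]
  ring

lemma lintegral_enorm_sq_ne_top {N : ℕ} (g : 𝓢(RN N, ℂ)) : ∫⁻ x, ‖g x‖ₑ ^ 2 ≠ ⊤ := by
  rw [lintegral_enorm_sq]
  exact ENNReal.ofReal_ne_top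

lemma lintegral_enorm_sq_ne_zero {N : ℕ} {g : 𝓢(RN N, ℂ)} (hg : ⇑g ≠ 0) :
    ∫⁻ x, ‖g x‖ₑ ^ 2 ≠ 0 := by
  have hc := g.continuous
  intro h
  rw [lintegral_eq_zero_iff (by fun_prop)] at h
  refine hg ((hc.ae_eq_iff_eq volume continuous_zero).1 (h.mono fun x hx => ?_))
  simpa using hx

theorem stmt6 {N : ℕ} (W : WeightFunction) (g : SchwartzMap (RN N) ℂ)
    (hg : SOmega W ⇑g) (hg0 : ⇑g ≠ 0)
    (lam : ℝ) (hlam : 0 ≤ lam)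
    (f : SchwartzMap (RN N) ℂ) (hf : SOmega W ⇑f) :
    wnorm W lam MeasureTheory.volume (fun z : RN N × RN N => rihaczek ⇑f z.1 z.2) ⊤ ≤
      ENNReal.ofReal (((2 * Real.pi) ^ (2 * N))⁻¹ *
        ((MeasureTheory.eLpNorm ⇑g 2 MeasureTheory.volume).toReal ^ 4)⁻¹ *
        Real.exp (W.K * (1 + 2 * W.K) * lam) *
        (wnorm W (W.K ^ 2 * lam) MeasureTheory.volume ⇑g ⊤).toReal *
        (wnorm W (W.K ^ 2 * lam) MeasureTheory.volume (ftr ⇑g) ⊤).toReal *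
        ((wnorm W (W.K ^ 2 * lam) MeasureTheory.volume
          (fun z : RN N × RN N => stft ⇑g ⇑f z.1 z.2) 1).toReal) ^ 2) := by
  have hgS : W.RapidDecay g := WeightFunction.rapidDecay_of_pos fun μ hμ => (hg μ hμ).1
  have hfS : W.RapidDecay f := WeightFunction.rapidDecay_of_pos fun μ hμ => (hf μ hμ).1
  have hgS' : W.RapidDecay g.ftr := WeightFunction.rapidDecay_of_pos fun μ hμ => by
    rw [g.coe_ftr]; exact (hg μ hμ).2
  have hfS' : W.RapidDecay f.ftr := WeightFunction.rapidDecay_of_pos fun μ hμ => by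
    rw [f.coe_ftr]; exact (hf μ hμ).2
  have hK : 1 ≤ W.K := W.oneLeK
  have hKlam : 0 ≤ W.K * lam := by positivity
  have hKK : W.K ^ 2 * lam = W.K * (W.K * lam) := by ring
  have hpi : (0 : ℝ) < (2 * Real.pi) ^ N := by positivity
  rw [WeightFunction.wnorm_one, ← g.coe_ftr, eLpNorm_two_toReal_pow_four, hKK]
  have hIA := hgS.wnorm_top_ne_top (W.K * (W.K * lam))
  have hIB := hgS'.wnorm_top_ne_top (W.K * (W.K * lam))
  have hI := hgS.lintegral_stft_ne_top hfS hgS' hfS' (μ := W.K * (W.K * lam)) (by positivity)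
  have h1 : ∀ x, _ := fun x => WeightFunction.exp_mul_le_of_le_lintegral (p := Prod.fst)
    norm_fst_le hIA hKlam (WeightFunction.exp_mul_enorm_le_wnorm_top g.continuous _)
    (enorm_mul_lintegral_le g f x)
  have h2 : ∀ ξ, _ := fun ξ => WeightFunction.exp_mul_le_of_le_lintegral (p := Prod.snd)
    norm_snd_le hIB hKlam (WeightFunction.exp_mul_enorm_le_wnorm_top g.ftr.continuous _)
    (enorm_ftr_mul_lintegral_le g f ξ)
  have hG := ENNReal.toReal_pos (lintegral_enorm_sq_ne_zero hg0) (lintegral_enorm_sq_ne_top g)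
  set G := ∫⁻ x, ‖g x‖ₑ ^ 2
  set A := wnorm W (W.K * (W.K * lam)) volume g ⊤
  set B := wnorm W (W.K * (W.K * lam)) volume g.ftr ⊤
  set I := ∫⁻ z : RN N × RN N, ENNReal.ofReal (Real.exp (W.K * (W.K * lam) * W.w ‖z‖)) *
    ‖stft g f z.1 z.2‖ₑ
  rw [wnorm, eLpNorm_exponent_top]
  refine eLpNormEssSup_le_of_ae_bound (.of_forall fun z => ?_)
  have h1' := ENNReal.toReal_mono (by finiteness) (h1 z.1)
  have h2' := ENNReal.toReal_mono (by finiteness) (h2 z.2)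
  simp only [ENNReal.toReal_mul, ENNReal.toReal_ofReal (Real.exp_pos _).le,
    ENNReal.toReal_ofReal hpi.le, toReal_enorm] at h1' h2'
  have hw : Real.exp (lam * W.w ‖z‖) ≤ Real.exp (W.K * lam) *
      (Real.exp (W.K * lam * W.w ‖z.1‖) * Real.exp (W.K * lam * W.w ‖z.2‖)) := by
    rw [← Real.exp_add, ← Real.exp_add, Real.exp_le_exp]
    have hz : W.w ‖z‖ ≤ W.K * (1 + W.w ‖z.1‖ + W.w ‖z.2‖) :=
      (W.mono (norm_nonneg _) (Set.mem_Ici.2 (by positivity))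
        (max_le_add_of_nonneg (norm_nonneg _) (norm_nonneg _))).trans
        (W.subadd _ _ (norm_nonneg _) (norm_nonneg _))
    nlinarith [mul_le_mul_of_nonneg_left hz hlam]
  have hE : Real.exp (W.K * (1 + 2 * W.K) * lam) = Real.exp (W.K * lam) *
      (Real.exp (W.K * (W.K * lam)) * Real.exp (W.K * (W.K * lam))) := by
    rw [← Real.exp_add, ← Real.exp_add]
    ring_nf
  rw [Real.norm_of_nonneg (by positivity), rihaczek, norm_mul, norm_mul, norm_exp_neg_I_dotR,
    one_mul, RCLike.norm_conj, ← f.coe_ftr, hE]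
  have hprod := mul_le_mul h1' h2' (by positivity) (by positivity)
  have hP : 0 < ((2 * Real.pi) ^ N) ^ 2 * G.toReal ^ 2 := by positivity
  rw [← mul_le_mul_iff_right₀ hP]
  calc _ ≤ ((2 * Real.pi) ^ N) ^ 2 * G.toReal ^ 2 * (Real.exp (W.K * lam) *
      (Real.exp (W.K * lam * W.w ‖z.1‖) * Real.exp (W.K * lam * W.w ‖z.2‖)) *
      (‖f z.1‖ * ‖f.ftr z.2‖)) := by gcongr
    _ = Real.exp (W.K * lam) * (Real.exp (W.K * lam * W.w ‖z.1‖) * ((2 * Real.pi) ^ N *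
      (‖f z.1‖ * G.toReal)) * (Real.exp (W.K * lam * W.w ‖z.2‖) * ((2 * Real.pi) ^ N *
      (‖f.ftr z.2‖ * G.toReal)))) := by ring
    _ ≤ _ := mul_le_mul_of_nonneg_left hprod (Real.exp_pos _).le
    _ = _ := by
      rw [show (2 * Real.pi) ^ (2 * N) = ((2 * Real.pi) ^ N) ^ 2 by ring]
      field_simp
end

section
/- There is no constant D > 0 and exponent p ≥ 2 such that ‖Rf‖_∞ ≤ D ‖Wig(f)‖_p for all f ∈ 𝒮(ℝᴺ). Equivalently, since Wig : L²×L² → L^p is bounded for p ≥ 2, the quantity F(f) := ‖f‖_∞ ‖f̂‖_∞ / ‖f‖₂² is unbounded on 𝒮(ℝᴺ)∖{0}. -/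
open MeasureTheory Complex ENNReal

/-- The Gaussian `exp (-(a * ∑ xᵢ²))` as a Schwartz function on `ℝᴺ` with the sup norm. -/
noncomputable def gaussianSchwartz (N : ℕ) (a : ℝ) (ha : 0 < a) : SchwartzMap (RN N) ℝ where
  toFun := Real.exp ∘ fun x => -(a * ∑ i, x i ^ 2)
  smooth' := Real.contDiff_exp.comp (by fun_prop)
  decay' := by
    intro m n
    have hq : Function.HasTemperateGrowth (fun x : RN N => -(a * ∑ i, x i ^ 2)) := by
      have (i : Fin N) : Function.HasTemperateGrowth (fun x : RN N => x i) :=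
        (ContinuousLinearMap.proj (R := ℝ) (φ := fun _ : Fin N => ℝ) i).hasTemperateGrowth
      refine .neg (.mul (.const a) (.sum fun i _ => ?_))
      exact (this i).pow 2
    obtain ⟨k, C, hC, hD⟩ := hq.norm_iteratedFDeriv_le_uniform n
    refine ⟨n.factorial * (1 + C) ^ n * ((m + k * n).factorial * Real.exp (1 + 1 / (4 * a))),
      fun x => ?_⟩
    set r := ‖x‖ with hr
    have hr0 : 0 ≤ r := norm_nonneg x
    set E := Real.exp (-(a * ∑ i, x i ^ 2)) with hE
    have hder : ‖iteratedFDeriv ℝ n (Real.exp ∘ fun x : RN N => -(a * ∑ i, x i ^ 2)) x‖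
        ≤ n.factorial * E * ((1 + C) * (1 + r) ^ k) ^ n := by
      refine norm_iteratedFDeriv_comp_le (N := (n : ℕ∞)) Real.contDiff_exp
        (by fun_prop) le_rfl x (fun i _ => ?_) (fun i hi hin => ?_)
      · rw [norm_iteratedFDeriv_eq_norm_iteratedDeriv, iteratedDeriv_eq_iterate,
          Real.iter_deriv_exp, Real.norm_of_nonneg (Real.exp_pos _).le]
      · have h1 : (1 : ℝ) ≤ (1 + r) ^ k := one_le_pow₀ (by linarith)
        calc _ ≤ C * (1 + r) ^ k := hD i hin x
          _ ≤ (1 + C) * (1 + r) ^ k := by gcongr; linarith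
          _ ≤ _ := le_self_pow₀ (by nlinarith) (by omega)
    have hsum : r ^ 2 ≤ ∑ i, x i ^ 2 := by
      have : r ≤ √(∑ i, x i ^ 2) := by
        refine (pi_norm_le_iff_of_nonneg (Real.sqrt_nonneg _)).2 fun i => ?_
        exact Real.abs_le_sqrt
          (Finset.single_le_sum (f := fun i => x i ^ 2) (fun i _ => sq_nonneg _)
            (Finset.mem_univ i))
      calc r ^ 2 ≤ √(∑ i, x i ^ 2) ^ 2 := by gcongr
        _ = _ := Real.sq_sqrt (Finset.sum_nonneg fun i _ => sq_nonneg _)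
    have hpow : (1 + r) ^ (m + k * n) * E
        ≤ (m + k * n).factorial * Real.exp (1 + 1 / (4 * a)) := by
      have h1 : (1 + r) ^ (m + k * n) ≤ (m + k * n).factorial * Real.exp (1 + r) := by
        have := Real.pow_div_factorial_le_exp (1 + r) (by linarith) (m + k * n)
        rwa [div_le_iff₀' (by positivity)] at this
      have h2 : Real.exp (1 + r) * E ≤ Real.exp (1 + 1 / (4 * a)) := by
        rw [hE, ← Real.exp_add, Real.exp_le_exp]
        have h3 : r - a * r ^ 2 ≤ 1 / (4 * a) := by
          rw [le_div_iff₀ (by positivity)]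
          nlinarith [sq_nonneg (2 * a * r - 1)]
        nlinarith [mul_le_mul_of_nonneg_left hsum ha.le]
      calc _ ≤ (m + k * n).factorial * Real.exp (1 + r) * E := by gcongr
        _ ≤ _ := by rw [mul_assoc]; gcongr
    calc r ^ m * ‖iteratedFDeriv ℝ n (Real.exp ∘ fun x : RN N => -(a * ∑ i, x i ^ 2)) x‖
        ≤ (1 + r) ^ m * (n.factorial * E * ((1 + C) * (1 + r) ^ k) ^ n) := by
          gcongr; linarith
      _ = n.factorial * (1 + C) ^ n * ((1 + r) ^ (m + k * n) * E) := by
          rw [mul_pow, ← pow_mul, pow_add]; ring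
      _ ≤ _ := by gcongr

/-- The dilated Gaussian `uᴺ exp (-u⁴ |x|²)`, whose `L²` norm does not depend on `u`. -/
noncomputable def dilGaussian (N : ℕ) (u : ℝ) (hu : 0 < u) : SchwartzMap (RN N) ℂ :=
  ((u : ℂ) ^ N) • (gaussianSchwartz N (u ^ 4) (by positivity)).postcompCLM Complex.ofRealCLM

lemma dilGaussian_apply {N : ℕ} {u : ℝ} (hu : 0 < u) (x : RN N) :
    dilGaussian N u hu x = (u : ℂ) ^ N * cexp (-((u : ℂ) ^ 4 * ∑ i, (x i : ℂ) ^ 2)) := by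
  have : gaussianSchwartz N (u ^ 4) (by positivity) x =
      Real.exp (-(u ^ 4 * ∑ i, x i ^ 2)) := rfl
  simp [dilGaussian, this]

/-- The modulus of the cross-Wigner transform of two dilated Gaussians. -/
noncomputable def crossKernel (N : ℕ) (u v : ℝ) (z : RN N × RN N) : ℝ :=
  (u * v * √(4 * Real.pi / (u ^ 4 + v ^ 4))) ^ N *
    (Real.exp (-(4 * u ^ 4 * v ^ 4 / (u ^ 4 + v ^ 4) * ∑ i, z.1 i ^ 2)) *
      Real.exp (-(1 / (u ^ 4 + v ^ 4) * ∑ i, z.2 i ^ 2)))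

/-- The integrand of the cross-Wigner transform. -/
noncomputable def crossIntegrand {N : ℕ} (f g : RN N → ℂ) (x ξ t : RN N) : ℂ :=
  cexp (-(Complex.I * (dotR t ξ : ℂ))) * f (x + (1 / 2 : ℝ) • t) *
    (starRingEnd ℂ) (g (x - (1 - (1 / 2 : ℝ)) • t))

lemma crossIntegrand_dilGaussian {N : ℕ} {u v : ℝ} (hu : 0 < u) (hv : 0 < v) (x ξ t : RN N) :
    crossIntegrand (dilGaussian N u hu) (dilGaussian N v hv) x ξ t =
      (((u * v) ^ N * Real.exp (-((u ^ 4 + v ^ 4) * ∑ i, x i ^ 2)) : ℝ) : ℂ) *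
        cexp (-(((u ^ 4 + v ^ 4) / 4 : ℝ) : ℂ) * ∑ i, (t i : ℂ) ^ 2 +
          ∑ i, (-(((u ^ 4 - v ^ 4) * x i : ℝ) + (ξ i : ℂ) * Complex.I)) * t i) := by
  simp only [crossIntegrand, dilGaussian_apply, map_mul, map_pow, Complex.conj_ofReal,
    ← Complex.exp_conj]
  push_cast
  simp only [map_neg, map_mul, map_sum, map_pow, Complex.conj_ofReal]
  rw [show ∀ a b c d e : ℂ, a * (b * c) * (d * e) = (b * d) * (a * c * e) by intros; ring,
    mul_pow, mul_assoc (_ * _) (cexp _) (cexp _), ← Complex.exp_add, ← Complex.exp_add,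
    ← Complex.exp_add]
  congr 2
  simp only [dotR, Finset.mul_sum, Complex.ofReal_sum, ← Finset.sum_neg_distrib,
    ← Finset.sum_add_distrib]
  refine Finset.sum_congr rfl fun i _ => ?_
  simp
  ring

lemma integrable_crossIntegrand {N : ℕ} {u v : ℝ} (hu : 0 < u) (hv : 0 < v) (x ξ : RN N) :
    Integrable (crossIntegrand (dilGaussian N u hu) (dilGaussian N v hv) x ξ) := by
  have hb : 0 < (((u ^ 4 + v ^ 4) / 4 : ℝ) : ℂ).re := by
    rw [Complex.ofReal_re]; positivity
  refine ((GaussianFourier.integrable_cexp_neg_mul_sum_add hb _).const_mul _).congr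
    (.of_forall fun t => (crossIntegrand_dilGaussian hu hv x ξ t).symm)

lemma norm_integral_crossIntegrand {N : ℕ} {u v : ℝ} (hu : 0 < u) (hv : 0 < v) (x ξ : RN N) :
    ‖∫ t, crossIntegrand (dilGaussian N u hu) (dilGaussian N v hv) x ξ t‖ =
      crossKernel N u v (x, ξ) := by
  have hs : 0 < u ^ 4 + v ^ 4 := by positivity
  have hb : 0 < (((u ^ 4 + v ^ 4) / 4 : ℝ) : ℂ).re := by
    rw [Complex.ofReal_re]; positivity
  simp_rw [crossIntegrand_dilGaussian hu hv x ξ]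
  rw [integral_const_mul, GaussianFourier.integral_cexp_neg_mul_sum_add hb, norm_mul, norm_mul,
    Complex.norm_exp, Complex.norm_real, Real.norm_of_nonneg (by positivity),
    ← Complex.ofReal_div, Complex.norm_cpow_eq_rpow_re_of_pos (by positivity)]
  have h1 : (Real.pi / ((u ^ 4 + v ^ 4) / 4)) ^ ((Fintype.card (Fin N) : ℂ) / 2).re =
      √(4 * Real.pi / (u ^ 4 + v ^ 4)) ^ N := by
    rw [show Real.pi / ((u ^ 4 + v ^ 4) / 4) = 4 * Real.pi / (u ^ 4 + v ^ 4) by field_simp,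
      Real.sqrt_eq_rpow, ← Real.rpow_natCast _ N, ← Real.rpow_mul (by positivity)]
    congr 1
    simp
    ring
  have h2 : ((∑ i, (-(((u ^ 4 - v ^ 4) * x i : ℝ) + (ξ i : ℂ) * Complex.I)) ^ 2) /
      (4 * (((u ^ 4 + v ^ 4) / 4 : ℝ) : ℂ))).re =
      ∑ i, ((u ^ 4 - v ^ 4) ^ 2 * x i ^ 2 - ξ i ^ 2) / (u ^ 4 + v ^ 4) := by
    rw [show (4 * (((u ^ 4 + v ^ 4) / 4 : ℝ) : ℂ)) = ((u ^ 4 + v ^ 4 : ℝ) : ℂ) by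
      push_cast; ring, Complex.div_ofReal_re, Complex.re_sum, Finset.sum_div]
    refine Finset.sum_congr rfl fun i _ => ?_
    congr 1
    simp only [sq, Complex.mul_re, Complex.neg_re, Complex.neg_im, Complex.add_re,
      Complex.add_im, Complex.ofReal_re, Complex.ofReal_im, Complex.mul_im, Complex.I_re,
      Complex.I_im]
    ring
  rw [h1, h2, crossKernel, mul_pow, ← Real.exp_add,
    show ∀ a b c d : ℝ, a * b * (c * d) = a * c * (b * d) by intros; ring, ← Real.exp_add]
  congr 2
  · ring
  simp only [Finset.mul_sum, ← Finset.sum_neg_distrib, ← Finset.sum_add_distrib]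
  refine Finset.sum_congr rfl fun i _ => ?_
  field_simp
  ring

lemma norm_wig_dilGaussian_add_le {N : ℕ} {u v : ℝ} (hu : 0 < u) (hv : 0 < v) (x ξ : RN N) :
    ‖wig (1 / 2 : ℝ) (dilGaussian N u hu + dilGaussian N v hv) x ξ‖ ≤
      crossKernel N u u (x, ξ) + crossKernel N u v (x, ξ) +
        (crossKernel N v u (x, ξ) + crossKernel N v v (x, ξ)) := by
  have : wig (1 / 2 : ℝ) (dilGaussian N u hu + dilGaussian N v hv) x ξ =
      (∫ t, crossIntegrand (dilGaussian N u hu) (dilGaussian N u hu) x ξ t) +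
      (∫ t, crossIntegrand (dilGaussian N u hu) (dilGaussian N v hv) x ξ t) +
      ((∫ t, crossIntegrand (dilGaussian N v hv) (dilGaussian N u hu) x ξ t) +
      (∫ t, crossIntegrand (dilGaussian N v hv) (dilGaussian N v hv) x ξ t)) := by
    have huu := integrable_crossIntegrand hu hu x ξ
    have huv := integrable_crossIntegrand hu hv x ξ
    have hvu := integrable_crossIntegrand hv hu x ξ
    have hvv := integrable_crossIntegrand hv hv x ξ
    rw [← integral_add' huu huv, ← integral_add' hvu hvv,
      ← integral_add' (huu.add huv) (hvu.add hvv)]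
    refine integral_congr_ae (.of_forall fun t => ?_)
    simp only [crossIntegrand, Pi.add_apply, IsAddApply.add_apply, map_add]
    ring
  rw [this, ← norm_integral_crossIntegrand hu hu, ← norm_integral_crossIntegrand hu hv,
    ← norm_integral_crossIntegrand hv hu, ← norm_integral_crossIntegrand hv hv]
  exact (norm_add_le _ _).trans (add_le_add (norm_add_le _ _) (norm_add_le _ _))

lemma integrable_exp_neg_mul_sum_sq (N : ℕ) {c : ℝ} (hc : 0 < c) :
    Integrable (fun x : RN N => Real.exp (-(c * ∑ i, x i ^ 2))) := by
  simp_rw [Finset.mul_sum, ← Finset.sum_neg_distrib, Real.exp_sum, ← neg_mul]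
  exact .fintype_prod (f := fun _ (y : ℝ) => Real.exp (-c * y ^ 2))
    fun _ => integrable_exp_neg_mul_sq hc

lemma integral_exp_neg_mul_sum_sq (N : ℕ) (c : ℝ) :
    ∫ x : RN N, Real.exp (-(c * ∑ i, x i ^ 2)) = √(Real.pi / c) ^ N := by
  simp_rw [Finset.mul_sum, ← Finset.sum_neg_distrib, Real.exp_sum, ← neg_mul]
  rw [integral_fintype_prod_volume_eq_pow fun y : ℝ => Real.exp (-c * y ^ 2), integral_gaussian,
    Fintype.card_fin]

lemma crossKernel_nonneg (N : ℕ) {u v : ℝ} (hu : 0 < u) (hv : 0 < v) (z : RN N × RN N) :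
    0 ≤ crossKernel N u v z := by
  unfold crossKernel; positivity

lemma crossKernel_le (N : ℕ) {u v : ℝ} (hu : 0 < u) (hv : 0 < v) (z : RN N × RN N) :
    crossKernel N u v z ≤ 4 ^ N := by
  have hs : 0 < u ^ 4 + v ^ 4 := by positivity
  have hm : u * v * √(4 * Real.pi / (u ^ 4 + v ^ 4)) ≤ 4 := by
    refine le_of_sq_le_sq ?_ (by norm_num)
    rw [mul_pow, Real.sq_sqrt (by positivity), ← mul_div_assoc, div_le_iff₀ hs]
    nlinarith [sq_nonneg (u ^ 2 - v ^ 2), Real.pi_lt_four, Real.pi_pos, sq_nonneg (u * v)]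
  have h (c : ℝ) (hc : 0 ≤ c) (x : RN N) : Real.exp (-(c * ∑ i, x i ^ 2)) ≤ 1 :=
    Real.exp_le_one_iff.2 (neg_nonpos.2
      (mul_nonneg hc (Finset.sum_nonneg fun i _ => sq_nonneg _)))
  calc crossKernel N u v z ≤ 4 ^ N * (1 * 1) := by
        unfold crossKernel
        gcongr
        · exact h _ (by positivity) _
        · exact h _ (by positivity) _
    _ = 4 ^ N := by ring

lemma lintegral_crossKernel_sq (N : ℕ) {u v : ℝ} (hu : 0 < u) (hv : 0 < v) :
    ∫⁻ z, ‖crossKernel N u v z‖ₑ ^ 2 = ENNReal.ofReal ((Real.pi ^ 2) ^ N) := by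
  set α := 4 * u ^ 4 * v ^ 4 / (u ^ 4 + v ^ 4) with hα
  set β := 1 / (u ^ 4 + v ^ 4) with hβ
  set m := u * v * √(4 * Real.pi / (u ^ 4 + v ^ 4)) with hm
  have hα0 : 0 < 2 * α := by positivity
  have hβ0 : 0 < 2 * β := by positivity
  have hsq (z : RN N × RN N) : crossKernel N u v z ^ 2 = (m ^ 2) ^ N *
      (Real.exp (-(2 * α * ∑ i, z.1 i ^ 2)) * Real.exp (-(2 * β * ∑ i, z.2 i ^ 2))) := by
    rw [crossKernel, mul_pow, mul_pow (Real.exp _), ← Real.exp_nat_mul, ← Real.exp_nat_mul,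
      pow_right_comm]
    push_cast
    congr 3 <;> ring
  have hint : Integrable (fun z : RN N × RN N => crossKernel N u v z ^ 2) := by
    simp_rw [hsq]
    exact ((integrable_exp_neg_mul_sum_sq N hα0).mul_prod
      (integrable_exp_neg_mul_sum_sq N hβ0)).const_mul _
  have hval : ∫ z : RN N × RN N, crossKernel N u v z ^ 2 = (Real.pi ^ 2) ^ N := by
    simp_rw [hsq]
    rw [integral_const_mul, Measure.volume_eq_prod,
      integral_prod_mul (fun x : RN N => Real.exp (-(2 * α * ∑ i, x i ^ 2)))
        (fun x : RN N => Real.exp (-(2 * β * ∑ i, x i ^ 2))),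
      integral_exp_neg_mul_sum_sq, integral_exp_neg_mul_sum_sq, ← mul_pow, ← mul_pow]
    congr 1
    rw [← Real.sqrt_mul (by positivity), hm, mul_pow, Real.sq_sqrt (by positivity)]
    rw [show Real.pi / (2 * α) * (Real.pi / (2 * β)) =
        (Real.pi * (u ^ 4 + v ^ 4) / (4 * u ^ 2 * v ^ 2)) ^ 2 by
      rw [hα, hβ]; field_simp; ring, Real.sqrt_sq (by positivity)]
    field_simp
  rw [← hval, ofReal_integral_eq_lintegral_ofReal hint (.of_forall fun z => sq_nonneg _)]
  refine lintegral_congr fun z => ?_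
  rw [ENNReal.ofReal_pow (crossKernel_nonneg N hu hv z),
    Real.enorm_of_nonneg (crossKernel_nonneg N hu hv z)]

/-- Interpolation: a uniform bound and an `L²` bound control every `Lᵖ` norm with `2 ≤ p`. -/
lemma exists_eLpNorm_le_of_bound_of_lintegral_sq {α : Type*} [MeasurableSpace α] (μ : Measure α)
    {p c M : ℝ≥0∞} (hp : 2 ≤ p) (hc : c ≠ ∞) (hM : M ≠ ∞) :
    ∃ K : ℝ≥0∞, K ≠ ∞ ∧ ∀ g : α → ℝ, (∀ z, ‖g z‖ₑ ≤ c) → ∫⁻ z, ‖g z‖ₑ ^ 2 ∂μ ≤ M →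
      eLpNorm g p μ ≤ K := by
  rcases eq_or_ne p ∞ with rfl | hpt
  · refine ⟨c, hc, fun g hg _ => ?_⟩
    rw [eLpNorm_exponent_top]
    exact eLpNormEssSup_le_of_ae_enorm_bound (.of_forall hg)
  have hp2 : 2 ≤ p.toReal := by simpa using ENNReal.toReal_mono hpt hp
  refine ⟨(c ^ (p.toReal - 2) * M) ^ (1 / p.toReal), ?_, fun g hg h2 => ?_⟩
  · exact ENNReal.rpow_ne_top_of_nonneg (by positivity)
      (ENNReal.mul_ne_top (ENNReal.rpow_ne_top_of_nonneg (by linarith) hc) hM)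
  rw [eLpNorm_eq_lintegral_rpow_enorm_toReal (by positivity) hpt]
  refine ENNReal.rpow_le_rpow ?_ (by positivity)
  calc ∫⁻ z, ‖g z‖ₑ ^ p.toReal ∂μ
      ≤ ∫⁻ z, c ^ (p.toReal - 2) * ‖g z‖ₑ ^ 2 ∂μ := by
        refine lintegral_mono fun z => ?_
        calc ‖g z‖ₑ ^ p.toReal = ‖g z‖ₑ ^ (p.toReal - 2) * ‖g z‖ₑ ^ 2 := by
              rw [← ENNReal.rpow_two, ← ENNReal.rpow_add_of_nonneg _ _ (by linarith)
                (by norm_num), sub_add_cancel]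
          _ ≤ _ := by gcongr; exact hg z
    _ = c ^ (p.toReal - 2) * ∫⁻ z, ‖g z‖ₑ ^ 2 ∂μ :=
        lintegral_const_mul' _ _ (ENNReal.rpow_ne_top_of_nonneg (by linarith) hc)
    _ ≤ _ := by gcongr

lemma exists_eLpNorm_crossKernel_le (N : ℕ) {p : ℝ≥0∞} (hp : 2 ≤ p) :
    ∃ K : ℝ≥0∞, K ≠ ∞ ∧ ∀ u v : ℝ, 0 < u → 0 < v →
      eLpNorm (crossKernel N u v) p volume ≤ K := by
  obtain ⟨K, hK, h⟩ := exists_eLpNorm_le_of_bound_of_lintegral_sq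
    (volume : Measure (RN N × RN N)) hp (ENNReal.ofReal_ne_top (r := 4 ^ N))
    (ENNReal.ofReal_ne_top (r := (Real.pi ^ 2) ^ N))
  refine ⟨K, hK, fun u v hu hv => h _ (fun z => ?_) (lintegral_crossKernel_sq N hu hv).le⟩
  rw [Real.enorm_of_nonneg (crossKernel_nonneg N hu hv z)]
  exact ENNReal.ofReal_le_ofReal (crossKernel_le N hu hv z)

lemma continuous_crossKernel (N : ℕ) (u v : ℝ) : Continuous (crossKernel N u v) := by
  unfold crossKernel; fun_prop

lemma exists_eLpNorm_wig_dilGaussian_add_le (N : ℕ) {p : ℝ≥0∞} (hp : 2 ≤ p) :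
    ∃ K : ℝ≥0∞, K ≠ ∞ ∧ ∀ (u v : ℝ) (hu : 0 < u) (hv : 0 < v),
      eLpNorm (fun z : RN N × RN N =>
        wig (1 / 2 : ℝ) (dilGaussian N u hu + dilGaussian N v hv) z.1 z.2) p volume ≤ K := by
  obtain ⟨K, hK, h⟩ := exists_eLpNorm_crossKernel_le N hp
  have hp1 : 1 ≤ p := le_trans (by norm_num) hp
  have hmeas (u v : ℝ) : AEStronglyMeasurable (crossKernel N u v) :=
    (continuous_crossKernel N u v).aestronglyMeasurable
  refine ⟨K + K + (K + K), by simp [hK], fun u v hu hv => ?_⟩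
  calc _ ≤ eLpNorm ((crossKernel N u u + crossKernel N u v) +
        (crossKernel N v u + crossKernel N v v)) p volume :=
        eLpNorm_mono_real fun z => norm_wig_dilGaussian_add_le hu hv z.1 z.2
    _ ≤ eLpNorm (crossKernel N u u + crossKernel N u v) p volume +
        eLpNorm (crossKernel N v u + crossKernel N v v) p volume :=
        eLpNorm_add_le ((hmeas _ _).add (hmeas _ _)) ((hmeas _ _).add (hmeas _ _)) hp1
    _ ≤ _ := by
        refine add_le_add ?_ ?_
        · exact (eLpNorm_add_le (hmeas _ _) (hmeas _ _) hp1).trans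
            (add_le_add (h u u hu hu) (h u v hu hv))
        · exact (eLpNorm_add_le (hmeas _ _) (hmeas _ _) hp1).trans
            (add_le_add (h v u hv hu) (h v v hv hv))

lemma integral_dilGaussian (N : ℕ) {u : ℝ} (hu : 0 < u) :
    ∫ x, dilGaussian N u hu x = (((√Real.pi / u) ^ N : ℝ) : ℂ) := by
  have (x : RN N) : dilGaussian N u hu x =
      ((u ^ N * Real.exp (-(u ^ 4 * ∑ i, x i ^ 2)) : ℝ) : ℂ) := by
    rw [dilGaussian_apply]; push_cast; rfl
  simp_rw [this]
  rw [integral_complex_ofReal, integral_const_mul, integral_exp_neg_mul_sum_sq, ← mul_pow,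
    Real.sqrt_div' _ (by positivity), show u ^ 4 = (u ^ 2) ^ 2 by ring,
    Real.sqrt_sq (by positivity)]
  congr 2
  field_simp

lemma le_norm_rihaczek_dilGaussian_add {N : ℕ} (hN : 0 < N) {u : ℝ} (hu : 0 < u) (hu1 : 1 ≤ u) :
    u ≤ ‖rihaczek (dilGaussian N u hu + dilGaussian N u⁻¹ (inv_pos.2 hu)) 0 0‖ := by
  have hf : (dilGaussian N u hu + dilGaussian N u⁻¹ (inv_pos.2 hu)) 0 =
      ((u ^ N + u⁻¹ ^ N : ℝ) : ℂ) := by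
    simp [dilGaussian_apply]
  have hft : ftr (dilGaussian N u hu + dilGaussian N u⁻¹ (inv_pos.2 hu)) 0 =
      (((√Real.pi / u) ^ N + (√Real.pi * u) ^ N : ℝ) : ℂ) := by
    have h0 (x : RN N) : dotR x 0 = 0 := by simp [dotR]
    simp only [ftr, h0, Complex.ofReal_zero, mul_zero, neg_zero, Complex.exp_zero, one_mul,
      IsAddApply.add_apply]
    rw [integral_add (SchwartzMap.integrable _) (SchwartzMap.integrable _),
      integral_dilGaussian, integral_dilGaussian, div_inv_eq_mul, Complex.ofReal_add]
  have hπ : 1 ≤ √Real.pi := Real.one_le_sqrt.2 (by linarith [Real.pi_gt_three])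
  rw [rihaczek, hf, hft, Complex.conj_ofReal, norm_mul, norm_mul, Complex.norm_real,
    Complex.norm_real, Real.norm_of_nonneg (by positivity), Real.norm_of_nonneg (by positivity)]
  simp only [dotR, Pi.zero_apply, mul_zero, Finset.sum_const_zero, Complex.ofReal_zero, neg_zero,
    Complex.exp_zero, norm_one, one_mul]
  have h1 : u ≤ u ^ N + u⁻¹ ^ N :=
    (le_self_pow₀ hu1 hN.ne').trans (le_add_of_nonneg_right (by positivity))
  have h2 : 1 ≤ (√Real.pi / u) ^ N + (√Real.pi * u) ^ N :=
    (one_le_pow₀ (one_le_mul_of_one_le_of_one_le hπ hu1)).trans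
      (le_add_of_nonneg_left (by positivity))
  exact h1.trans (le_mul_of_one_le_right (by positivity) h2)

theorem stmt7 {N : ℕ} (hN : 0 < N) :
    ¬ ∃ (D : ℝ) (p : ℝ≥0∞), 0 < D ∧ 2 ≤ p ∧
      ∀ f : SchwartzMap (RN N) ℂ, ∀ x ξ : RN N,
        ‖rihaczek ⇑f x ξ‖ ≤ D *
          (MeasureTheory.eLpNorm
            (fun z : RN N × RN N => wig (1/2 : ℝ) ⇑f z.1 z.2) p
            MeasureTheory.volume).toReal := by
  rintro ⟨D, p, hD, hp, h⟩
  obtain ⟨K, hK, hle⟩ := exists_eLpNorm_wig_dilGaussian_add_le N hp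
  set u : ℝ := D * K.toReal + 1 with hu_def
  have hu1 : 1 ≤ u := le_add_of_nonneg_left (by positivity)
  have hu : 0 < u := by linarith
  have hRf := h (dilGaussian N u hu + dilGaussian N u⁻¹ (inv_pos.2 hu)) 0 0
  have hW := ENNReal.toReal_mono hK (hle u u⁻¹ hu (inv_pos.2 hu))
  have := (le_norm_rihaczek_dilGaussian_add hN hu hu1).trans
    (hRf.trans (mul_le_mul_of_nonneg_left hW hD.le))
  linarith
end
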